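/- Fix γ > 0, T > 0, and bounds μ, ρ, ν > 0. There exists C ≥ 1, depending only on γ, T, μ, ρ, ν (and independent of ε), such that the following holds for every ε ∈ (0,1]: if ξ, η : [0,T] × ℝ → ℝ are continuous in t and smooth mean-zero 2π-periodic in x with sup_{0≤t≤T} ‖ξ(t,·)‖_{H³} ≤ ρ and sup_{0≤t≤T} ‖η(t,·)‖_{H¹} ≤ ν, and v is a smooth solution on [0,T] of the regularized equation ∂_t v + γ v + ∂_x³ v + ∂_x(ξ v) + v ∂_x v + ε ∂_x⁴ v = η with ‖v(0,·)‖_{L²} + ‖v(0,·)‖_{H¹} ≤ μ, then sup_{0≤t≤T} ‖v(t,·)‖_{H¹} + ε^{1/2} ( ∫₀^T ‖v(t,·)‖_{H³}² dt )^{1/2} ≤ C. -/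

import Mathlib

open MeasureTheory Real Filter Topology

noncomputable section

/-- A smooth, mean-zero, `2π`-periodic function `v : ℝ → ℝ`. -/
def SmoothMeanZeroPeriodic (v : ℝ → ℝ) : Prop :=
  ContDiff ℝ (⊤ : ℕ∞) v ∧ (∀ x : ℝ, v (x + 2 * Real.pi) = v x) ∧
    (∫ x in (0:ℝ)..(2 * Real.pi), v x) = 0

/-- The `L²` norm over one period: `(∫₀^{2π} |v|²)^{1/2}`. -/
def L2norm (v : ℝ → ℝ) : ℝ := Real.sqrt (∫ x in (0:ℝ)..(2 * Real.pi), (v x) ^ 2)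

/-- The homogeneous Sobolev norm `‖v‖_{H^m} = ‖D^m v‖_{L²}`. -/
def Hnorm (m : ℕ) (v : ℝ → ℝ) : ℝ := L2norm (iteratedDeriv m v)

/-- Time-dependent data on `[0,T]`: continuous in `t`, smooth mean-zero `2π`-periodic
in `x`, with `H^k` norm bounded by `ρ` for each `t ∈ [0,T]`. -/
def RegData (T : ℝ) (k : ℕ) (ρ : ℝ) (ξ : ℝ → ℝ → ℝ) : Prop :=
  (∀ x : ℝ, Continuous fun t => ξ t x) ∧
  (∀ t : ℝ, 0 ≤ t → t ≤ T → SmoothMeanZeroPeriodic (ξ t)) ∧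
  (∀ t : ℝ, 0 ≤ t → t ≤ T → Hnorm k (ξ t) ≤ ρ)

/-- A smooth solution on `[0,T]` of the regularized equation
`∂ₜv + γv + ∂ₓ³v + ∂ₓ(ξ v) + v ∂ₓv + ε ∂ₓ⁴v = η`,
mean-zero `2π`-periodic in `x`. -/
def IsRegSol (γ ε T : ℝ) (ξ η v : ℝ → ℝ → ℝ) : Prop :=
  ContDiff ℝ (⊤ : ℕ∞) (fun p : ℝ × ℝ => v p.1 p.2) ∧
  (∀ t : ℝ, 0 ≤ t → t ≤ T → SmoothMeanZeroPeriodic (v t)) ∧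
  (∀ t x : ℝ, 0 ≤ t → t ≤ T →
    deriv (fun s => v s x) t + γ * v t x + iteratedDeriv 3 (v t) x
      + deriv (fun y => ξ t y * v t y) x + v t x * deriv (v t) x
      + ε * iteratedDeriv 4 (v t) x = η t x)

theorem hasDerivAt_iteratedDeriv_of_smooth {f : ℝ → ℝ} (hf : ContDiff ℝ (⊤ : ℕ∞) f) (k : ℕ)
    (x : ℝ) : HasDerivAt (iteratedDeriv k f) (iteratedDeriv (k + 1) f x) x := by
  rw [iteratedDeriv_succ]
  exact ((hf.differentiable_iteratedDeriv k (by exact_mod_cast WithTop.coe_lt_top _)) x).hasDerivAt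

theorem periodic_iteratedDeriv {f : ℝ → ℝ} {c : ℝ} (hf : ∀ x, f (x + c) = f x) (k : ℕ) (x : ℝ) :
    iteratedDeriv k f (x + c) = iteratedDeriv k f x := by
  have h := iteratedDeriv_comp_add_const k f c
  rw [← congrFun h x]
  congr 1
  exact funext hf

theorem integral_deriv_eq_zero {h h' : ℝ → ℝ} {a b : ℝ} (hd : ∀ x, HasDerivAt h (h' x) x)
    (hc : Continuous h') (hp : h b = h a) : ∫ x in a..b, h' x = 0 := by
  rw [intervalIntegral.integral_eq_sub_of_hasDerivAt (fun x _ => hd x)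
    (hc.intervalIntegrable _ _), hp, sub_self]

theorem integral_congr_add_deriv {A B h h' : ℝ → ℝ} {a b : ℝ} (hB : Continuous B)
    (hd : ∀ x, HasDerivAt h (h' x) x) (hc : Continuous h') (hp : h b = h a)
    (hAB : ∀ x, A x = B x + h' x) : ∫ x in a..b, A x = ∫ x in a..b, B x := by
  have : A = fun x => B x + h' x := funext hAB
  rw [this, intervalIntegral.integral_add (hB.intervalIntegrable _ _) (hc.intervalIntegrable _ _),
    integral_deriv_eq_zero hd hc hp, add_zero]

theorem sq_integral_mul_le {f g : ℝ → ℝ} {a b : ℝ} (hab : a ≤ b) (hf : Continuous f)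
    (hg : Continuous g) :
    (∫ x in a..b, f x * g x) ^ 2 ≤ (∫ x in a..b, f x ^ 2) * ∫ x in a..b, g x ^ 2 := by
  have key : ∀ r : ℝ, 0 ≤ (∫ x in a..b, g x ^ 2) * (r * r) + (2 * ∫ x in a..b, f x * g x) * r
      + ∫ x in a..b, f x ^ 2 := by
    intro r
    have h0 : 0 ≤ ∫ x in a..b, (f x + r * g x) ^ 2 :=
      intervalIntegral.integral_nonneg hab fun x _ => sq_nonneg _
    have h1 : ∫ x in a..b, (f x + r * g x) ^ 2 = (∫ x in a..b, g x ^ 2) * (r * r)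
        + (2 * ∫ x in a..b, f x * g x) * r + ∫ x in a..b, f x ^ 2 := by
      rw [← intervalIntegral.integral_const_mul, ← intervalIntegral.integral_mul_const,
        ← intervalIntegral.integral_mul_const, ← intervalIntegral.integral_add,
        ← intervalIntegral.integral_add]
      · congr 1; ext x; ring
      all_goals exact Continuous.intervalIntegrable (by fun_prop) _ _
    rwa [h1] at h0
  have := discrim_le_zero key
  unfold discrim at this
  nlinarith

/-- A mean-zero function on one period is bounded by the `L²` norm of its derivative. -/
theorem sq_le_integral_deriv_sq {f f' : ℝ → ℝ} (hd : ∀ x, HasDerivAt f (f' x) x)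
    (hc : Continuous f') (hm : ∫ x in (0 : ℝ)..(2 * π), f x = 0) {x : ℝ}
    (hx : x ∈ Set.Icc 0 (2 * π)) : f x ^ 2 ≤ 2 * π * ∫ y in (0 : ℝ)..(2 * π), f' y ^ 2 := by
  have hpi := Real.pi_pos
  have hfc : Continuous f := continuous_iff_continuousAt.2 fun x => (hd x).continuousAt
  set S := ∫ y in (0 : ℝ)..(2 * π), |f' y| with hS
  have hosc : ∀ y ∈ Set.Icc 0 (2 * π), |f x - f y| ≤ S := by
    intro y hy
    rw [← intervalIntegral.integral_eq_sub_of_hasDerivAt (fun z _ => hd z)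
      (hc.intervalIntegrable y x)]
    refine (intervalIntegral.norm_integral_le_integral_norm_uIoc (f := f')).trans ?_
    rw [hS, intervalIntegral.integral_of_le (by positivity)]
    refine setIntegral_mono_set ?_ (Eventually.of_forall fun z => abs_nonneg _) ?_
    · exact (hc.abs.intervalIntegrable 0 (2 * π)).1
    · refine (Set.uIoc_subset_uIoc_of_uIcc_subset_uIcc ?_).trans
        (Set.uIoc_of_le (by positivity)).subset |>.eventuallyLE
      rw [Set.uIcc_of_le (by positivity : (0 : ℝ) ≤ 2 * π)]
      exact Set.uIcc_subset_Icc hy hx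
  have hmean : 2 * π * f x = ∫ y in (0 : ℝ)..(2 * π), (f x - f y) := by
    rw [intervalIntegral.integral_sub (by simp) (hfc.intervalIntegrable _ _), hm]
    simp
  have hle : |2 * π * f x| ≤ S * |2 * π - 0| := by
    rw [hmean, ← Real.norm_eq_abs]
    refine intervalIntegral.norm_integral_le_of_norm_le_const fun y hy => ?_
    rw [Set.uIoc_of_le (by positivity)] at hy
    exact hosc y ⟨hy.1.le, hy.2⟩
  have hfS : |f x| ≤ S := by
    rw [abs_mul, sub_zero, mul_comm S] at hle
    exact le_of_mul_le_mul_left hle (by positivity)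
  have hCS := sq_integral_mul_le (a := 0) (b := 2 * π) (by positivity) hc.abs
    (continuous_const (y := (1 : ℝ)))
  simp only [mul_one, sq_abs, one_pow, intervalIntegral.integral_const, sub_zero, smul_eq_mul]
    at hCS
  calc f x ^ 2 = |f x| ^ 2 := (sq_abs _).symm
    _ ≤ S ^ 2 := pow_le_pow_left₀ (abs_nonneg _) hfS 2
    _ ≤ _ := by rw [mul_comm (2 * π)]; exact hCS

/-- Differentiation under the integral sign for jointly continuous derivatives. -/
theorem hasDerivAt_integral_of_continuous {F F' : ℝ → ℝ → ℝ} {a b : ℝ}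
    (hF : Continuous fun p : ℝ × ℝ => F p.1 p.2) (hF' : Continuous fun p : ℝ × ℝ => F' p.1 p.2)
    (hd : ∀ t x, HasDerivAt (fun s => F s x) (F' t x) t) (t : ℝ) :
    HasDerivAt (fun s => ∫ x in a..b, F s x) (∫ x in a..b, F' t x) t := by
  obtain ⟨M, hM⟩ := ((isCompact_Icc (a := t - 1) (b := t + 1)).prod
    (isCompact_uIcc (a := a) (b := b))).exists_bound_of_continuousOn hF'.continuousOn
  have hslice : ∀ s, Continuous (F s) := fun s => hF.comp (by fun_prop : Continuous fun x => (s, x))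
  have hslice' : Continuous (F' t) := hF'.comp (by fun_prop : Continuous fun x => (t, x))
  refine (intervalIntegral.hasDerivAt_integral_of_dominated_loc_of_deriv_le (F := F) (F' := F')
    (bound := fun _ => M) (Icc_mem_nhds (by linarith : t - 1 < t) (by linarith : t < t + 1))
    (Eventually.of_forall fun s => (hslice s).aestronglyMeasurable)
    ((hslice t).intervalIntegrable _ _) hslice'.aestronglyMeasurable
    (Eventually.of_forall fun x hx s hs => hM (s, x) ⟨hs, Set.uIoc_subset_uIcc hx⟩) (by simp)
    (Eventually.of_forall fun x _ s _ => hd s x)).2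

/-- A Gronwall inequality that keeps track of a dissipation term `N`. -/
theorem gronwall_dissipation {E E' N : ℝ → ℝ} {K T : ℝ} (hK : 0 ≤ K)
    (hE : ∀ t, HasDerivAt E (E' t) t) (hN : Continuous N) (hN0 : ∀ t, 0 ≤ N t)
    (hle : ∀ t, 0 ≤ t → t ≤ T → E' t ≤ K * (E t + 1) - N t) {t : ℝ} (ht : 0 ≤ t) (htT : t ≤ T) :
    exp (-K * t) * (E t + 1) + exp (-K * T) * ∫ s in (0 : ℝ)..t, N s ≤ E 0 + 1 := by
  have hd : ∀ t, HasDerivAt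
      (fun t => exp (-K * t) * (E t + 1) + exp (-K * T) * ∫ s in (0 : ℝ)..t, N s)
      ((exp (-K * t) * (-K * 1)) * (E t + 1) + exp (-K * t) * E' t + exp (-K * T) * N t) t := by
    intro t
    exact ((((hasDerivAt_id t).const_mul (-K)).exp).mul ((hE t).add_const 1)).add
      ((hN.integral_hasStrictDerivAt 0 t).hasDerivAt.const_mul _)
  have hanti : AntitoneOn
      (fun t => exp (-K * t) * (E t + 1) + exp (-K * T) * ∫ s in (0 : ℝ)..t, N s)
      (Set.Icc 0 T) := by
    refine antitoneOn_of_hasDerivWithinAt_nonpos (convex_Icc 0 T)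
      (fun t _ => (hd t).continuousAt.continuousWithinAt)
      (fun t _ => (hd t).hasDerivWithinAt) fun t ht => ?_
    rw [interior_Icc] at ht
    have h1 := hle t ht.1.le ht.2.le
    have h2 : exp (-K * T) ≤ exp (-K * t) := exp_le_exp.2 (by nlinarith [ht.2])
    have h3 := mul_le_mul_of_nonneg_right h2 (hN0 t)
    have h4 := mul_le_mul_of_nonneg_left h1 (exp_pos (-K * t)).le
    nlinarith
  have := hanti (Set.mem_Icc.2 ⟨le_rfl, ht.trans htT⟩) (Set.mem_Icc.2 ⟨ht, htT⟩) ht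
  simpa using this

theorem modified_energy_density_le {γ ε a B y0 y1 y3 z1 z2 e0 e1 : ℝ} (hγ : 0 ≤ γ) (hε : 0 ≤ ε)
    (ha : 0 ≤ a) (hs : y0 ^ 2 ≤ B) (h₁ : |z1| ≤ a) (h₂ : |z2| ≤ a) :
    -2 * γ * y1 ^ 2 + γ * y0 ^ 3 - 2 * z2 * y0 * y1 - 3 * z1 * y1 ^ 2 + 2 / 3 * z1 * y0 ^ 3
      - 2 * ε * y3 ^ 2 - 2 * ε * y0 * y1 * y3 + 2 * y1 * e1 - y0 ^ 2 * e0 ≤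
    (γ + 2 * a + (γ + a + 1) * B) * y0 ^ 2 + (4 * a + 1 + ε * B) * y1 ^ 2 + e0 ^ 2 + e1 ^ 2
      - ε * y3 ^ 2 := by
  have a1 := abs_le.1 h₁
  have a2 := abs_le.1 h₂
  have q4 : y0 ^ 4 ≤ B * y0 ^ 2 := by nlinarith [mul_le_mul_of_nonneg_right hs (sq_nonneg y0)]
  have q22 : y0 ^ 2 * y1 ^ 2 ≤ B * y1 ^ 2 := mul_le_mul_of_nonneg_right hs (sq_nonneg y1)
  have c3 : |y0 ^ 3| ≤ y0 ^ 2 + B * y0 ^ 2 := by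
    rw [abs_le]
    constructor <;> nlinarith [sq_nonneg (y0 ^ 2 + y0), sq_nonneg (y0 ^ 2 - y0), sq_nonneg y0]
  have b1 : γ * y0 ^ 3 ≤ γ * (y0 ^ 2 + B * y0 ^ 2) :=
    mul_le_mul_of_nonneg_left ((le_abs_self _).trans c3) hγ
  have b2 : -(2 * z2 * y0 * y1) ≤ a * (y0 ^ 2 + y1 ^ 2) := by
    nlinarith [mul_nonneg (by linarith : 0 ≤ a - z2) (sq_nonneg (y0 - y1)),
      mul_nonneg (by linarith : 0 ≤ a + z2) (sq_nonneg (y0 + y1))]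
  have b3 : -(3 * z1 * y1 ^ 2) ≤ 3 * a * y1 ^ 2 := by
    nlinarith [mul_nonneg (by linarith : 0 ≤ a + z1) (sq_nonneg y1)]
  have b4 : 2 / 3 * z1 * y0 ^ 3 ≤ a * (y0 ^ 2 + B * y0 ^ 2) := by
    have : |z1 * y0 ^ 3| ≤ a * (y0 ^ 2 + B * y0 ^ 2) := by
      rw [abs_mul]
      exact mul_le_mul h₁ c3 (abs_nonneg _) ha
    have := le_abs_self (z1 * y0 ^ 3)
    have := abs_nonneg (z1 * y0 ^ 3)
    linarith
  have b5 : -(2 * ε * y0 * y1 * y3) ≤ ε * y3 ^ 2 + ε * (B * y1 ^ 2) := by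
    nlinarith [mul_nonneg hε (sq_nonneg (y0 * y1 + y3)), mul_le_mul_of_nonneg_left q22 hε]
  have b6 : 2 * y1 * e1 ≤ y1 ^ 2 + e1 ^ 2 := by nlinarith [sq_nonneg (y1 - e1)]
  have b7 : -(y0 ^ 2 * e0) ≤ B * y0 ^ 2 + e0 ^ 2 := by
    nlinarith [sq_nonneg (y0 ^ 2 + e0), sq_nonneg (y0 ^ 2), sq_nonneg e0]
  have b8 := mul_nonneg hγ (sq_nonneg y1)
  linarith

/-- A sequence of functions, each the derivative of the preceding one, that take the same values
at `0` and `2π`, the first one having mean zero. -/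
structure MeanZeroJet (f : ℕ → ℝ → ℝ) : Prop where
  hasDerivAt : ∀ k x, HasDerivAt (f k) (f (k + 1) x) x
  periodic : ∀ k, f k (2 * π) = f k 0
  mean_zero : ∫ x in (0 : ℝ)..(2 * π), f 0 x = 0

theorem SmoothMeanZeroPeriodic.meanZeroJet {f : ℝ → ℝ} (hf : SmoothMeanZeroPeriodic f) :
    MeanZeroJet fun k => iteratedDeriv k f where
  hasDerivAt := hasDerivAt_iteratedDeriv_of_smooth hf.1
  periodic k := by simpa using periodic_iteratedDeriv hf.2.1 k 0
  mean_zero := by simpa using hf.2.2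

namespace MeanZeroJet

variable {f : ℕ → ℝ → ℝ}

theorem continuous (hf : MeanZeroJet f) (k : ℕ) : Continuous (f k) :=
  continuous_iff_continuousAt.2 fun x => (hf.hasDerivAt k x).continuousAt

theorem integral_eq_zero (hf : MeanZeroJet f) : ∀ k, ∫ x in (0 : ℝ)..(2 * π), f k x = 0
  | 0 => hf.mean_zero
  | k + 1 => integral_deriv_eq_zero (hf.hasDerivAt k) (hf.continuous _) (hf.periodic k)

theorem sq_le (hf : MeanZeroJet f) (k : ℕ) {x : ℝ} (hx : x ∈ Set.Icc 0 (2 * π)) :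
    f k x ^ 2 ≤ 2 * π * ∫ y in (0 : ℝ)..(2 * π), f (k + 1) y ^ 2 :=
  sq_le_integral_deriv_sq (hf.hasDerivAt k) (hf.continuous _) (hf.integral_eq_zero k) hx

theorem integral_sq_le (hf : MeanZeroJet f) (k : ℕ) {M : ℝ}
    (hM : ∀ x ∈ Set.Icc 0 (2 * π), f k x ^ 2 ≤ M) :
    ∫ y in (0 : ℝ)..(2 * π), f k y ^ 2 ≤ 2 * π * M := by
  have := intervalIntegral.integral_mono_on (μ := volume) (by positivity : (0 : ℝ) ≤ 2 * π)
    (((hf.continuous k).pow 2).intervalIntegrable _ _) (by simp) hM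
  simpa using this

theorem sq_integral_sq_le (hf : MeanZeroJet f) :
    (∫ y in (0 : ℝ)..(2 * π), f 1 y ^ 2) ^ 2 ≤
      (∫ y in (0 : ℝ)..(2 * π), f 0 y ^ 2) * ∫ y in (0 : ℝ)..(2 * π), f 2 y ^ 2 := by
  have c0 := hf.continuous 0
  have c1 := hf.continuous 1
  have c2 := hf.continuous 2
  have h : ∫ y in (0 : ℝ)..(2 * π), f 1 y ^ 2 = ∫ y in (0 : ℝ)..(2 * π), -(f 0 y * f 2 y) := by
    refine integral_congr_add_deriv (by fun_prop)
      (fun x => (hf.hasDerivAt 0 x).mul (hf.hasDerivAt 1 x)) (by fun_prop) ?_ fun x => by ring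
    simp [hf.periodic]
  rw [h, intervalIntegral.integral_neg, neg_sq]
  exact sq_integral_mul_le (by positivity) c0 c2

theorem integral_quartic_le (hf : MeanZeroJet f) :
    ∫ y in (0 : ℝ)..(2 * π), f 0 y ^ 4 ≤
      2 * π * (∫ y in (0 : ℝ)..(2 * π), f 1 y ^ 2) * ∫ y in (0 : ℝ)..(2 * π), f 0 y ^ 2 := by
  have c0 := hf.continuous 0
  rw [← intervalIntegral.integral_const_mul]
  refine intervalIntegral.integral_mono_on (by positivity)
    (Continuous.intervalIntegrable (by fun_prop) _ _)
    (Continuous.intervalIntegrable (by fun_prop) _ _) fun x hx => ?_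
  have := mul_le_mul_of_nonneg_right (hf.sq_le 0 hx) (sq_nonneg (f 0 x))
  calc f 0 x ^ 4 = f 0 x ^ 2 * f 0 x ^ 2 := by ring
    _ ≤ _ := this

theorem abs_integral_cube_le (hf : MeanZeroJet f) {R : ℝ} (hR : 0 < R)
    (hfR : ∫ y in (0 : ℝ)..(2 * π), f 0 y ^ 2 ≤ R) :
    |∫ y in (0 : ℝ)..(2 * π), f 0 y ^ 3| ≤
      (∫ y in (0 : ℝ)..(2 * π), f 1 y ^ 2) + π * R ^ 2 / 2 := by
  have c0 := hf.continuous 0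
  have hpi := Real.pi_pos
  have h4 := hf.integral_quartic_le
  set N₁ := ∫ y in (0 : ℝ)..(2 * π), f 1 y ^ 2
  have hN₁ : 0 ≤ N₁ := intervalIntegral.integral_nonneg (by positivity) fun x _ => sq_nonneg _
  set N₀ := ∫ y in (0 : ℝ)..(2 * π), f 0 y ^ 2
  set N₄ := ∫ y in (0 : ℝ)..(2 * π), f 0 y ^ 4
  have h : |∫ y in (0 : ℝ)..(2 * π), f 0 y ^ 3| ≤
      ∫ y in (0 : ℝ)..(2 * π), (1 / (2 * π * R) * f 0 y ^ 4 + π * R / 2 * f 0 y ^ 2) := by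
    refine (intervalIntegral.abs_integral_le_integral_abs (by positivity)).trans ?_
    refine intervalIntegral.integral_mono_on (by positivity)
      (Continuous.intervalIntegrable (by fun_prop) _ _)
      (Continuous.intervalIntegrable (by fun_prop) _ _) fun x _ => ?_
    have hsq : 0 ≤ 1 / (2 * π * R) * (|f 0 x| ^ 2 - π * R * |f 0 x|) ^ 2 := by positivity
    have e : 1 / (2 * π * R) * (|f 0 x| ^ 2 - π * R * |f 0 x|) ^ 2 =
        1 / (2 * π * R) * f 0 x ^ 4 + π * R / 2 * f 0 x ^ 2 - |f 0 x ^ 3| := by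
      rw [abs_pow, ← sq_abs (f 0 x), ← (by decide : Even 4).pow_abs (f 0 x)]
      field_simp
      ring
    linarith
  rw [intervalIntegral.integral_add (Continuous.intervalIntegrable (by fun_prop) _ _)
    (Continuous.intervalIntegrable (by fun_prop) _ _), intervalIntegral.integral_const_mul,
    intervalIntegral.integral_const_mul] at h
  have h1 : 1 / (2 * π * R) * N₄ ≤ N₁ := by
    rw [one_div_mul_eq_div, div_le_iff₀ (by positivity)]
    calc N₄ ≤ 2 * π * N₁ * N₀ := h4
      _ ≤ 2 * π * N₁ * R := mul_le_mul_of_nonneg_left hfR (by positivity)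
      _ = _ := by ring
  have h2 : π * R / 2 * N₀ ≤ π * R / 2 * R := mul_le_mul_of_nonneg_left hfR (by positivity)
  nlinarith

/-- The dissipative `L²` estimate at a fixed time, `w` standing for the time derivative. -/
theorem energy_le {γ ε a : ℝ} {v ξ η : ℕ → ℝ → ℝ} {w : ℝ → ℝ} (hγ : 0 ≤ γ)
    (hv : MeanZeroJet v) (hξ : MeanZeroJet ξ) (hη : MeanZeroJet η)
    (hξ₁ : ∀ x ∈ Set.Icc 0 (2 * π), |ξ 1 x| ≤ a)
    (hw : ∀ x, w x + γ * v 0 x + v 3 x + (ξ 1 x * v 0 x + ξ 0 x * v 1 x) + v 0 x * v 1 x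
      + ε * v 4 x = η 0 x) :
    ∫ x in (0 : ℝ)..(2 * π), 2 * v 0 x * w x ≤
      (a + 1) * (∫ x in (0 : ℝ)..(2 * π), v 0 x ^ 2)
      + (∫ x in (0 : ℝ)..(2 * π), η 0 x ^ 2)
      - 2 * ε * ∫ x in (0 : ℝ)..(2 * π), v 2 x ^ 2 := by
  have v0 := hv.continuous 0
  have v1 := hv.continuous 1
  have v2 := hv.continuous 2
  have v3 := hv.continuous 3
  have v4 := hv.continuous 4
  have ξ0 := hξ.continuous 0
  have ξ1 := hξ.continuous 1
  have η0 := hη.continuous 0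
  have h : ∫ x in (0 : ℝ)..(2 * π), 2 * v 0 x * w x = ∫ x in (0 : ℝ)..(2 * π),
      (-2 * γ * v 0 x ^ 2 - ξ 1 x * v 0 x ^ 2 - 2 * ε * v 2 x ^ 2 + 2 * v 0 x * η 0 x) := by
    have d0 := hv.hasDerivAt 0
    have d1 := hv.hasDerivAt 1
    have d2 := hv.hasDerivAt 2
    have d3 := hv.hasDerivAt 3
    refine integral_congr_add_deriv
      (h := fun x => v 1 x * v 1 x - 2 * (v 0 x * v 2 x) - ξ 0 x * (v 0 x * v 0 x)
        - 2 / 3 * (v 0 x * (v 0 x * v 0 x)) - 2 * ε * (v 0 x * v 3 x - v 1 x * v 2 x))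
      (by fun_prop) (fun x => (((((d1 x).mul (d1 x)).sub (((d0 x).mul (d2 x)).const_mul 2)).sub
        ((hξ.hasDerivAt 0 x).mul ((d0 x).mul (d0 x)))).sub
        (((d0 x).mul ((d0 x).mul (d0 x))).const_mul (2 / 3))).sub
        ((((d0 x).mul (d3 x)).sub ((d1 x).mul (d2 x))).const_mul (2 * ε)))
      ?_ ?_ fun x => ?_
    · norm_num only [Pi.mul_apply]
      fun_prop
    · simp only [hv.periodic, hξ.periodic]
    · have : w x = η 0 x - (γ * v 0 x + v 3 x + (ξ 1 x * v 0 x + ξ 0 x * v 1 x) + v 0 x * v 1 x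
        + ε * v 4 x) := by linarith [hw x]
      norm_num only [Pi.mul_apply]
      rw [this]
      ring
  rw [h, ← intervalIntegral.integral_const_mul, ← intervalIntegral.integral_const_mul,
    ← intervalIntegral.integral_add (Continuous.intervalIntegrable (by fun_prop) _ _)
    (Continuous.intervalIntegrable (by fun_prop) _ _),
    ← intervalIntegral.integral_sub (Continuous.intervalIntegrable (by fun_prop) _ _)
    (Continuous.intervalIntegrable (by fun_prop) _ _)]
  refine intervalIntegral.integral_mono_on (by positivity)
    (Continuous.intervalIntegrable (by fun_prop) _ _)
    (Continuous.intervalIntegrable (by fun_prop) _ _) fun x hx => ?_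
  have h1 := mul_nonneg hγ (sq_nonneg (v 0 x))
  have h2 := mul_le_mul_of_nonneg_right (abs_le.1 (hξ₁ x hx)).1 (sq_nonneg (v 0 x))
  nlinarith [sq_nonneg (v 0 x - η 0 x)]

/-- The estimate for the modified `H¹` energy `∫ (v_x² - v³ / 3)` at a fixed time, `w` standing
for the time derivative and `w₁` for its space derivative. -/
theorem modified_energy_le {γ ε a : ℝ} {v ξ η : ℕ → ℝ → ℝ} {w w₁ : ℝ → ℝ} (hγ : 0 ≤ γ) (hε : 0 ≤ ε)
    (ha : 0 ≤ a) (hv : MeanZeroJet v) (hξ : MeanZeroJet ξ) (hη : MeanZeroJet η)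
    (hξ₁ : ∀ x ∈ Set.Icc 0 (2 * π), |ξ 1 x| ≤ a) (hξ₂ : ∀ x ∈ Set.Icc 0 (2 * π), |ξ 2 x| ≤ a)
    (hdw : ∀ x, HasDerivAt w (w₁ x) x) (hw₁ : Continuous w₁)
    (hw : ∀ x, w x + γ * v 0 x + v 3 x + (ξ 1 x * v 0 x + ξ 0 x * v 1 x) + v 0 x * v 1 x
      + ε * v 4 x = η 0 x) :
    ∫ x in (0 : ℝ)..(2 * π), (2 * v 1 x * w₁ x - v 0 x ^ 2 * w x) ≤
      (γ + 2 * a + (γ + a + 1) * (2 * π * ∫ x in (0 : ℝ)..(2 * π), v 1 x ^ 2))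
        * (∫ x in (0 : ℝ)..(2 * π), v 0 x ^ 2)
      + (4 * a + 1) * (∫ x in (0 : ℝ)..(2 * π), v 1 x ^ 2)
      + (∫ x in (0 : ℝ)..(2 * π), η 0 x ^ 2) + (∫ x in (0 : ℝ)..(2 * π), η 1 x ^ 2)
      + 2 * π * ε * ((∫ x in (0 : ℝ)..(2 * π), v 0 x ^ 2) * ∫ x in (0 : ℝ)..(2 * π), v 2 x ^ 2)
      - ε * ∫ x in (0 : ℝ)..(2 * π), v 3 x ^ 2 := by
  have v0 := hv.continuous 0
  have v1 := hv.continuous 1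
  have v2 := hv.continuous 2
  have v3 := hv.continuous 3
  have v4 := hv.continuous 4
  have ξ0 := hξ.continuous 0
  have ξ1 := hξ.continuous 1
  have ξ2 := hξ.continuous 2
  have η0 := hη.continuous 0
  have η1 := hη.continuous 1
  have wc : Continuous w := continuous_iff_continuousAt.2 fun x => (hdw x).continuousAt
  have hw' : ∀ x, w x = η 0 x - (γ * v 0 x + v 3 x + (ξ 1 x * v 0 x + ξ 0 x * v 1 x)
      + v 0 x * v 1 x + ε * v 4 x) := fun x => by linarith [hw x]
  have hwp : w (2 * π) = w 0 := by simp only [hw', hv.periodic, hξ.periodic, hη.periodic]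
  have h : ∫ x in (0 : ℝ)..(2 * π), (2 * v 1 x * w₁ x - v 0 x ^ 2 * w x) =
      ∫ x in (0 : ℝ)..(2 * π), (-2 * γ * v 1 x ^ 2 + γ * v 0 x ^ 3 - 2 * ξ 2 x * v 0 x * v 1 x
        - 3 * ξ 1 x * v 1 x ^ 2 + 2 / 3 * ξ 1 x * v 0 x ^ 3 - 2 * ε * v 3 x ^ 2
        - 2 * ε * v 0 x * v 1 x * v 3 x + 2 * v 1 x * η 1 x - v 0 x ^ 2 * η 0 x) := by
    have d0 := hv.hasDerivAt 0
    have d1 := hv.hasDerivAt 1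
    have d2 := hv.hasDerivAt 2
    have d3 := hv.hasDerivAt 3
    have k0 := hξ.hasDerivAt 0
    have k1 := hξ.hasDerivAt 1
    have g := fun x => ((d2 x).const_mul 2).add ((d0 x).mul (d0 x))
    refine integral_congr_add_deriv
      (h := fun x => 2 * (v 1 x * w x)
        + 1 / 4 * ((2 * v 2 x + v 0 x * v 0 x) * (2 * v 2 x + v 0 x * v 0 x))
        + 2 * γ * (v 0 x * v 1 x) + 2 * (ξ 1 x * (v 0 x * v 1 x)) + ξ 0 x * (v 1 x * v 1 x)
        + 1 / 3 * (ξ 0 x * (v 0 x * (v 0 x * v 0 x)))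
        + ε * ((2 * v 2 x + v 0 x * v 0 x) * v 3 x) - 2 * (v 1 x * η 0 x))
      (by fun_prop) (fun x => ((((((((d1 x).mul (hdw x)).const_mul 2).add
        (((g x).mul (g x)).const_mul (1 / 4))).add
        (((d0 x).mul (d1 x)).const_mul (2 * γ))).add
        (((k1 x).mul ((d0 x).mul (d1 x))).const_mul 2)).add
        ((k0 x).mul ((d1 x).mul (d1 x)))).add
        (((k0 x).mul ((d0 x).mul ((d0 x).mul (d0 x)))).const_mul (1 / 3))).add
        (((g x).mul (d3 x)).const_mul ε) |>.sub (((d1 x).mul (hη.hasDerivAt 0 x)).const_mul 2))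
      ?_ ?_ fun x => ?_
    · norm_num only [Pi.add_apply, Pi.mul_apply]
      fun_prop
    · simp only [hv.periodic, hξ.periodic, hη.periodic, hwp]
    · norm_num only [Pi.add_apply, Pi.mul_apply]
      rw [hw']
      ring
  have hinterp := mul_le_mul_of_nonneg_left hv.sq_integral_sq_le
    (by positivity : 0 ≤ 2 * π * ε)
  have hsup := fun x hx => hv.sq_le 0 (x := x) hx
  simp only [zero_add] at hsup
  set N₁ := ∫ x in (0 : ℝ)..(2 * π), v 1 x ^ 2 with hN₁
  set B := 2 * π * N₁ with hB
  have hmono : ∫ x in (0 : ℝ)..(2 * π), (2 * v 1 x * w₁ x - v 0 x ^ 2 * w x) ≤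
      ∫ x in (0 : ℝ)..(2 * π), ((γ + 2 * a + (γ + a + 1) * B) * v 0 x ^ 2
        + (4 * a + 1 + ε * B) * v 1 x ^ 2 + η 0 x ^ 2 + η 1 x ^ 2 - ε * v 3 x ^ 2) := by
    rw [h]
    refine intervalIntegral.integral_mono_on (by positivity)
      (Continuous.intervalIntegrable (by fun_prop) _ _)
      (Continuous.intervalIntegrable (by fun_prop) _ _) fun x hx => ?_
    exact modified_energy_density_le hγ hε ha (hsup x hx) (hξ₁ x hx) (hξ₂ x hx)
  refine hmono.trans ?_
  rw [intervalIntegral.integral_sub, intervalIntegral.integral_add, intervalIntegral.integral_add,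
    intervalIntegral.integral_add, intervalIntegral.integral_const_mul,
    intervalIntegral.integral_const_mul, intervalIntegral.integral_const_mul, ← hN₁]
  · have : (4 * a + 1 + ε * B) * N₁ = (4 * a + 1) * N₁ + 2 * π * ε * N₁ ^ 2 := by rw [hB]; ring
    linarith
  all_goals exact Continuous.intervalIntegrable (by fun_prop) _ _

end MeanZeroJet

/-- The time derivative of a function of `(t, x)`. -/
def timeDeriv (F : ℝ × ℝ → ℝ) (p : ℝ × ℝ) : ℝ := fderiv ℝ F p (1, 0)

/-- The space derivative of a function of `(t, x)`. -/
def spaceDeriv (F : ℝ × ℝ → ℝ) (p : ℝ × ℝ) : ℝ := fderiv ℝ F p (0, 1)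

section PartialDerivatives

variable {F : ℝ × ℝ → ℝ}

theorem contDiff_fderiv_apply_const (hF : ContDiff ℝ (⊤ : ℕ∞) F) (u : ℝ × ℝ) :
    ContDiff ℝ (⊤ : ℕ∞) fun p => fderiv ℝ F p u :=
  (hF.fderiv_right (by norm_num)).clm_apply contDiff_const

theorem contDiff_iterate_spaceDeriv (hF : ContDiff ℝ (⊤ : ℕ∞) F) (k : ℕ) :
    ContDiff ℝ (⊤ : ℕ∞) (spaceDeriv^[k] F) := by
  induction k with
  | zero => exact hF
  | succ k ih =>
    rw [Function.iterate_succ_apply']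
    exact contDiff_fderiv_apply_const ih _

theorem hasDerivAt_timeDeriv (hF : ContDiff ℝ (⊤ : ℕ∞) F) (t x : ℝ) :
    HasDerivAt (fun s => F (s, x)) (timeDeriv F (t, x)) t :=
  ((hF.differentiable (by simp)) (t, x)).hasFDerivAt.comp_hasDerivAt t
    ((hasDerivAt_id t).prodMk (hasDerivAt_const t x))

theorem hasDerivAt_spaceDeriv (hF : ContDiff ℝ (⊤ : ℕ∞) F) (t x : ℝ) :
    HasDerivAt (fun y => F (t, y)) (spaceDeriv F (t, x)) x :=
  ((hF.differentiable (by simp)) (t, x)).hasFDerivAt.comp_hasDerivAt x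
    ((hasDerivAt_const x t).prodMk (hasDerivAt_id x))

theorem iteratedDeriv_eq_iterate_spaceDeriv (hF : ContDiff ℝ (⊤ : ℕ∞) F) (t : ℝ) (k : ℕ) :
    iteratedDeriv k (fun x => F (t, x)) = fun x => (spaceDeriv^[k] F) (t, x) := by
  induction k with
  | zero => simp
  | succ k ih =>
    rw [iteratedDeriv_succ, ih]
    ext x
    rw [Function.iterate_succ_apply']
    exact (hasDerivAt_spaceDeriv (contDiff_iterate_spaceDeriv hF k) t x).deriv

theorem timeDeriv_spaceDeriv (hF : ContDiff ℝ (⊤ : ℕ∞) F) :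
    timeDeriv (spaceDeriv F) = spaceDeriv (timeDeriv F) := by
  ext p
  have hd : DifferentiableAt ℝ (fderiv ℝ F) p :=
    ((hF.fderiv_right (m := 1) (by norm_cast)).differentiable (by simp)) p
  have hs : IsSymmSndFDerivAt ℝ F p :=
    hF.contDiffAt.isSymmSndFDerivAt
      (by simpa using WithTop.coe_le_coe.2 (le_top : (2 : ℕ∞) ≤ ⊤))
  have e : ∀ u u' : ℝ × ℝ, fderiv ℝ (fun q => fderiv ℝ F q u) p u' =
      fderiv ℝ (fderiv ℝ F) p u' u := fun u u' => by
    rw [fderiv_clm_apply hd (differentiableAt_const u)]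
    simp
  exact (e _ _).trans ((hs _ _).trans (e _ _).symm)

end PartialDerivatives

theorem L2norm_sq (f : ℝ → ℝ) : L2norm f ^ 2 = ∫ x in (0 : ℝ)..(2 * π), f x ^ 2 :=
  Real.sq_sqrt (intervalIntegral.integral_nonneg (by positivity) fun x _ => sq_nonneg _)

theorem L2norm_nonneg (f : ℝ → ℝ) : 0 ≤ L2norm f := Real.sqrt_nonneg _

theorem integral_sq_le_of_Hnorm_le {f : ℝ → ℝ} {k : ℕ} {M : ℝ} (h : Hnorm k f ≤ M) :
    ∫ x in (0 : ℝ)..(2 * π), iteratedDeriv k f x ^ 2 ≤ M ^ 2 := by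
  rw [← L2norm_sq]
  exact pow_le_pow_left₀ (L2norm_nonneg _) h 2

theorem abs_iteratedDeriv_le_of_Hnorm_three_le {f : ℝ → ℝ} {M : ℝ}
    (hf : SmoothMeanZeroPeriodic f) (hM : 0 ≤ M) (h : Hnorm 3 f ≤ M) :
    ∀ x ∈ Set.Icc 0 (2 * π), |iteratedDeriv 1 f x| ≤ (2 * π) ^ 2 * M ∧
      |iteratedDeriv 2 f x| ≤ (2 * π) ^ 2 * M := by
  have hpi : 1 ≤ 2 * π := by linarith [Real.two_le_pi]
  have h3 := integral_sq_le_of_Hnorm_le h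
  have hj := hf.meanZeroJet
  have b2 : ∀ x ∈ Set.Icc 0 (2 * π), iteratedDeriv 2 f x ^ 2 ≤ 2 * π * M ^ 2 := fun x hx =>
    (hj.sq_le 2 hx).trans (mul_le_mul_of_nonneg_left h3 (by positivity))
  have b1 : ∀ x ∈ Set.Icc 0 (2 * π),
      iteratedDeriv 1 f x ^ 2 ≤ 2 * π * (2 * π * (2 * π * M ^ 2)) := fun x hx =>
    (hj.sq_le 1 hx).trans (mul_le_mul_of_nonneg_left (hj.integral_sq_le 2 b2) (by positivity))
  intro x hx
  constructor <;> refine abs_le_of_sq_le_sq ?_ (by positivity)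
  · refine (b1 x hx).trans ?_
    calc 2 * π * (2 * π * (2 * π * M ^ 2)) = (2 * π) ^ 3 * M ^ 2 := by ring
      _ ≤ (2 * π) ^ 4 * M ^ 2 :=
        mul_le_mul_of_nonneg_right (pow_le_pow_right₀ hpi (by norm_num)) (sq_nonneg M)
      _ = _ := by ring
  · refine (b2 x hx).trans ?_
    calc 2 * π * M ^ 2 = (2 * π) ^ 1 * M ^ 2 := by ring
      _ ≤ (2 * π) ^ 4 * M ^ 2 :=
        mul_le_mul_of_nonneg_right (pow_le_pow_right₀ hpi (by norm_num)) (sq_nonneg M)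
      _ = _ := by ring

theorem integral_sq_le_of_Hnorm_one_le {f : ℝ → ℝ} {M : ℝ}
    (hf : SmoothMeanZeroPeriodic f) (h : Hnorm 1 f ≤ M) :
    ∫ x in (0 : ℝ)..(2 * π), iteratedDeriv 0 f x ^ 2 ≤ (2 * π * M) ^ 2 := by
  have hj := hf.meanZeroJet
  have := hj.integral_sq_le 0 fun x hx => (hj.sq_le 0 hx).trans
    (mul_le_mul_of_nonneg_left (integral_sq_le_of_Hnorm_le h) (by positivity))
  calc _ ≤ 2 * π * (2 * π * M ^ 2) := this
    _ = _ := by ring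

/-- The `L²` bound produced by Gronwall's inequality. -/
def energyBound (a b T μ : ℝ) : ℝ := exp ((a + 1 + b) * T) * (μ ^ 2 + 1)

/-- The growth rate of the modified `H¹` energy, given a bound `R` for the squared `L²` norm. -/
def growthRate (γ a b R : ℝ) : ℝ :=
  (γ + 2 * a) * R + 2 * b + π * R * ((a + 1) * R + b)
    + 3 / 2 * ((γ + a + 1) * (2 * π) * R + (4 * a + 1))

/-- The bound for the modified `H¹` energy, given a bound `R` for the squared `L²` norm. -/
def modifiedEnergyBound (γ a b T μ R : ℝ) : ℝ :=
  exp (growthRate γ a b R * T) * (2 * μ ^ 2 + 2 * π * R ^ 2 + 1)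

theorem le_energyBound {N₀ N₀' : ℝ → ℝ} {a b T μ : ℝ} (ha : 0 ≤ a) (hb : 0 ≤ b)
    (n₀ : ∀ t, 0 ≤ N₀ t) (hd : ∀ t, HasDerivAt N₀ (N₀' t) t)
    (hle : ∀ t, 0 ≤ t → t ≤ T → N₀' t ≤ (a + 1) * N₀ t + b) (hμ : N₀ 0 ≤ μ ^ 2)
    {t : ℝ} (ht : 0 ≤ t) (htT : t ≤ T) : N₀ t ≤ energyBound a b T μ := by
  have h := gronwall_dissipation (N := fun _ => 0) (K := a + 1 + b) (T := T) (by positivity) hd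
    continuous_const (fun _ => le_rfl) (fun s h0 hT => by nlinarith [hle s h0 hT, n₀ s]) ht htT
  simp only [intervalIntegral.integral_zero, mul_zero, add_zero, neg_mul, Real.exp_neg] at h
  rw [inv_mul_le_iff₀ (exp_pos _)] at h
  have h1 : exp ((a + 1 + b) * t) ≤ exp ((a + 1 + b) * T) :=
    exp_le_exp.2 (mul_le_mul_of_nonneg_left htT (by positivity))
  have h2 := mul_le_mul h1 (by linarith : N₀ 0 + 1 ≤ μ ^ 2 + 1) (by linarith [n₀ 0]) (exp_pos _).le
  unfold energyBound
  linarith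

theorem bounds_of_energy_inequalities {N₀ N₁ N₂ N₃ Q N₀' I' : ℝ → ℝ} {γ ε a b T μ R : ℝ}
    (hγ : 0 ≤ γ) (hε : 0 ≤ ε) (ha : 0 ≤ a) (hb : 0 ≤ b) (hT : 0 ≤ T) (hR : 0 < R)
    (d₀ : ∀ t, HasDerivAt N₀ (N₀' t) t)
    (dI : ∀ t, HasDerivAt (fun s => N₁ s - 1 / 3 * Q s) (I' t) t)
    (c₃ : Continuous N₃) (n₀ : ∀ t, 0 ≤ N₀ t) (n₁ : ∀ t, 0 ≤ N₁ t) (n₂ : ∀ t, 0 ≤ N₂ t)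
    (n₃ : ∀ t, 0 ≤ N₃ t)
    (hN₀R : ∀ t, 0 ≤ t → t ≤ T → N₀ t ≤ R)
    (h₀ : ∀ t, 0 ≤ t → t ≤ T → N₀' t ≤ (a + 1) * N₀ t + b - 2 * ε * N₂ t)
    (hI : ∀ t, 0 ≤ t → t ≤ T → I' t ≤ (γ + 2 * a + (γ + a + 1) * (2 * π * N₁ t)) * N₀ t
      + (4 * a + 1) * N₁ t + b + b + 2 * π * ε * (N₀ t * N₂ t) - ε * N₃ t)
    (hQ : ∀ t, 0 ≤ t → t ≤ T → |Q t| ≤ N₁ t + π * R ^ 2 / 2) (hμ : N₁ 0 ≤ μ ^ 2) :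
    (∀ t, 0 ≤ t → t ≤ T → N₁ t ≤ 3 / 2 * modifiedEnergyBound γ a b T μ R) ∧
      ε * ∫ s in (0 : ℝ)..T, N₃ s ≤ modifiedEnergyBound γ a b T μ R := by
  have hpi := Real.pi_pos
  set K := growthRate γ a b R with hK
  have hK0 : 0 ≤ K := by rw [hK]; unfold growthRate; positivity
  set E : ℝ → ℝ := fun t => N₁ t - 1 / 3 * Q t + π * R * N₀ t + π * R ^ 2 / 6 with hE
  have hElow : ∀ t, 0 ≤ t → t ≤ T → 2 / 3 * N₁ t ≤ E t := by
    intro t h0 h1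
    have := (abs_le.1 (hQ t h0 h1)).2
    have : 0 ≤ π * R * N₀ t := mul_nonneg (by positivity) (n₀ t)
    simp only [hE]
    linarith
  have hdE : ∀ t, HasDerivAt E (I' t + π * R * N₀' t) t := fun t =>
    ((dI t).add ((d₀ t).const_mul (π * R))).add_const _
  have hE' : ∀ t, 0 ≤ t → t ≤ T → I' t + π * R * N₀' t ≤ K * (E t + 1) - ε * N₃ t := by
    intro t h0 h1
    have e0 := hN₀R t h0 h1
    have e1 := hElow t h0 h1
    have m1 := mul_le_mul_of_nonneg_left (h₀ t h0 h1) (by positivity : 0 ≤ π * R)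
    have m2 := mul_le_mul_of_nonneg_left e0 (by positivity : 0 ≤ γ + 2 * a)
    have m3 := mul_le_mul_of_nonneg_left e0
      (mul_nonneg (by positivity : 0 ≤ (γ + a + 1) * (2 * π)) (n₁ t))
    have m4 := mul_le_mul_of_nonneg_left e0
      (mul_nonneg (by positivity : 0 ≤ 2 * π * ε) (n₂ t))
    have m5 := mul_le_mul_of_nonneg_left e0 (by positivity : 0 ≤ π * R * (a + 1))
    set c₀ := (γ + 2 * a) * R + 2 * b + π * R * ((a + 1) * R + b) with hc₀
    set c₁ := (γ + a + 1) * (2 * π) * R + (4 * a + 1) with hc₁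
    have hc₀' : 0 ≤ c₀ := by positivity
    have hc₁' : 0 ≤ c₁ := by positivity
    have hKc : K = c₀ + 3 / 2 * c₁ := rfl
    have hsum : I' t + π * R * N₀' t ≤ c₀ + c₁ * N₁ t - ε * N₃ t := by
      rw [hc₀, hc₁]
      linarith [hI t h0 h1]
    have e2 : 0 ≤ E t := le_trans (by linarith [n₁ t]) e1
    have m6 := mul_le_mul_of_nonneg_left e1 hc₁'
    have m7 := mul_nonneg hc₀' e2
    rw [hKc]
    linarith
  have hgr := fun t (h0 : 0 ≤ t) (h1 : t ≤ T) => gronwall_dissipation hK0 hdE (c₃.const_mul ε)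
    (fun t => mul_nonneg hε (n₃ t)) hE' h0 h1
  have hE0 : E 0 + 1 ≤ 2 * μ ^ 2 + 2 * π * R ^ 2 + 1 := by
    have := (abs_le.1 (hQ 0 le_rfl hT)).1
    have := mul_le_mul_of_nonneg_left (hN₀R 0 le_rfl hT) (by positivity : 0 ≤ π * R)
    have : 0 ≤ π * R ^ 2 := by positivity
    simp only [hE]
    nlinarith [sq_nonneg μ]
  have hmul : ∀ s z : ℝ, s ≤ T → exp (-K * s) * z ≤ 2 * μ ^ 2 + 2 * π * R ^ 2 + 1 →
      z ≤ modifiedEnergyBound γ a b T μ R := by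
    intro s z hs hz
    rw [neg_mul, Real.exp_neg, inv_mul_le_iff₀ (exp_pos _)] at hz
    refine hz.trans (mul_le_mul_of_nonneg_right (exp_le_exp.2 ?_) (by positivity))
    exact mul_le_mul_of_nonneg_left hs hK0
  have hint : ∀ t, 0 ≤ t → 0 ≤ ∫ s in (0 : ℝ)..t, ε * N₃ s := fun t h0 =>
    intervalIntegral.integral_nonneg h0 fun s _ => mul_nonneg hε (n₃ s)
  refine ⟨fun t h0 h1 => ?_, ?_⟩
  · have := hmul t (E t + 1) h1 (by
      have := mul_nonneg (exp_pos (-K * T)).le (hint t h0)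
      linarith [hgr t h0 h1])
    linarith [hElow t h0 h1]
  · rw [← intervalIntegral.integral_const_mul]
    refine hmul T _ le_rfl ?_
    have : 0 ≤ exp (-K * T) * (E T + 1) :=
      mul_nonneg (exp_pos _).le (by linarith [hElow T hT le_rfl, n₁ T])
    linarith [hgr T hT le_rfl]

/-- The `H¹` bound and the dissipation bound for a solution of the regularized equation. -/
theorem IsRegSol.bounds {γ ε T μ ρ ν : ℝ} {ξ η v : ℝ → ℝ → ℝ} (hγ : 0 ≤ γ) (hε : 0 ≤ ε)
    (hT : 0 ≤ T) (hρ : 0 ≤ ρ) (hξ : RegData T 3 ρ ξ) (hη : RegData T 1 ν η)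
    (hv : IsRegSol γ ε T ξ η v) (hμ₀ : L2norm (v 0) ≤ μ) (hμ₁ : Hnorm 1 (v 0) ≤ μ) :
    let M := modifiedEnergyBound γ ((2 * π) ^ 2 * ρ) ((2 * π * ν) ^ 2) T μ
      (energyBound ((2 * π) ^ 2 * ρ) ((2 * π * ν) ^ 2) T μ)
    (∀ t, 0 ≤ t → t ≤ T → Hnorm 1 (v t) ^ 2 ≤ 3 / 2 * M) ∧
      ε * ∫ s in (0 : ℝ)..T, Hnorm 3 (v s) ^ 2 ≤ M := by
  have hpi := Real.pi_pos
  set a := (2 * π) ^ 2 * ρ with ha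
  set b := (2 * π * ν) ^ 2 with hb
  set R := energyBound a b T μ with hR
  have ha0 : 0 ≤ a := by positivity
  have hb0 : 0 ≤ b := by positivity
  have hR0 : 0 < R := by rw [hR]; unfold energyBound; positivity
  set F : ℝ × ℝ → ℝ := fun p => v p.1 p.2 with hF
  obtain ⟨hs, hper, heq⟩ := hv
  have hjetv : ∀ t k, iteratedDeriv k (v t) = fun x => (spaceDeriv^[k] F) (t, x) :=
    fun t k => iteratedDeriv_eq_iterate_spaceDeriv hs t k
  have hVc : ∀ k, Continuous fun p : ℝ × ℝ => iteratedDeriv k (v p.1) p.2 := fun k => by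
    simp only [hjetv]
    exact (contDiff_iterate_spaceDeriv hs k).continuous
  have hWs : ContDiff ℝ (⊤ : ℕ∞) (timeDeriv F) := contDiff_fderiv_apply_const hs _
  have hW₁s : ContDiff ℝ (⊤ : ℕ∞) (spaceDeriv (timeDeriv F)) := contDiff_fderiv_apply_const hWs _
  have hV₀t : ∀ t x, HasDerivAt (fun s => iteratedDeriv 0 (v s) x) (timeDeriv F (t, x)) t := by
    simp only [iteratedDeriv_zero]
    exact hasDerivAt_timeDeriv hs
  have hV₁t : ∀ t x, HasDerivAt (fun s => iteratedDeriv 1 (v s) x)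
      (spaceDeriv (timeDeriv F) (t, x)) t := by
    intro t x
    simp only [hjetv, Function.iterate_one]
    rw [← timeDeriv_spaceDeriv hs]
    exact hasDerivAt_timeDeriv (contDiff_fderiv_apply_const hs _) t x
  have V0 := hVc 0
  have V1 := hVc 1
  have V3 := hVc 3
  have W0 : Continuous fun p : ℝ × ℝ => timeDeriv F (p.1, p.2) := hWs.continuous
  have W1 : Continuous fun p : ℝ × ℝ => spaceDeriv (timeDeriv F) (p.1, p.2) := hW₁s.continuous
  have dN₀ : ∀ t, HasDerivAt (fun s => ∫ x in (0 : ℝ)..(2 * π), iteratedDeriv 0 (v s) x ^ 2)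
      (∫ x in (0 : ℝ)..(2 * π), 2 * iteratedDeriv 0 (v t) x * timeDeriv F (t, x)) t :=
    hasDerivAt_integral_of_continuous (F := fun s x => iteratedDeriv 0 (v s) x ^ 2)
      (F' := fun t x => 2 * iteratedDeriv 0 (v t) x * timeDeriv F (t, x))
      (by fun_prop) (by fun_prop) fun t x => by
        simpa using (hV₀t t x).fun_pow 2
  have hslice : ∀ k s, Continuous fun x => iteratedDeriv k (v s) x := fun k s =>
    (hVc k).comp (by fun_prop : Continuous fun x => (s, x))
  have dI : ∀ t, HasDerivAt (fun s => (∫ x in (0 : ℝ)..(2 * π), iteratedDeriv 1 (v s) x ^ 2)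
      - 1 / 3 * ∫ x in (0 : ℝ)..(2 * π), iteratedDeriv 0 (v s) x ^ 3)
      (∫ x in (0 : ℝ)..(2 * π), (2 * iteratedDeriv 1 (v t) x * spaceDeriv (timeDeriv F) (t, x)
        - iteratedDeriv 0 (v t) x ^ 2 * timeDeriv F (t, x))) t := by
    intro t
    have h := hasDerivAt_integral_of_continuous (a := 0) (b := 2 * π)
      (F := fun s x => iteratedDeriv 1 (v s) x ^ 2 - 1 / 3 * iteratedDeriv 0 (v s) x ^ 3)
      (F' := fun t x => 2 * iteratedDeriv 1 (v t) x * spaceDeriv (timeDeriv F) (t, x)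
        - iteratedDeriv 0 (v t) x ^ 2 * timeDeriv F (t, x))
      (by fun_prop) (by fun_prop)
      (fun t x => by
        refine (((hV₁t t x).pow 2).sub (((hV₀t t x).pow 3).const_mul (1 / 3))).congr_deriv ?_
        norm_num
        ring) t
    refine h.congr_of_eventuallyEq (Eventually.of_forall fun s => ?_)
    have h0 := hslice 0 s
    have h1 := hslice 1 s
    simp only
    rw [intervalIntegral.integral_sub (Continuous.intervalIntegrable (by fun_prop) _ _)
      (Continuous.intervalIntegrable (by fun_prop) _ _), intervalIntegral.integral_const_mul]
  have hvj : ∀ t, 0 ≤ t → t ≤ T → MeanZeroJet fun k => iteratedDeriv k (v t) :=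
    fun t h0 h1 => (hper t h0 h1).meanZeroJet
  have hξj : ∀ t, 0 ≤ t → t ≤ T → MeanZeroJet fun k => iteratedDeriv k (ξ t) :=
    fun t h0 h1 => (hξ.2.1 t h0 h1).meanZeroJet
  have hηj : ∀ t, 0 ≤ t → t ≤ T → MeanZeroJet fun k => iteratedDeriv k (η t) :=
    fun t h0 h1 => (hη.2.1 t h0 h1).meanZeroJet
  have hξb := fun t h0 h1 => abs_iteratedDeriv_le_of_Hnorm_three_le (hξ.2.1 t h0 h1) hρ
    (hξ.2.2 t h0 h1)
  have hη₀ : ∀ t, 0 ≤ t → t ≤ T → ∫ x in (0 : ℝ)..(2 * π), iteratedDeriv 0 (η t) x ^ 2 ≤ b :=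
    fun t h0 h1 => integral_sq_le_of_Hnorm_one_le (hη.2.1 t h0 h1) (hη.2.2 t h0 h1)
  have hη₁ : ∀ t, 0 ≤ t → t ≤ T → ∫ x in (0 : ℝ)..(2 * π), iteratedDeriv 1 (η t) x ^ 2 ≤ b := by
    intro t h0 h1
    refine (integral_sq_le_of_Hnorm_le (hη.2.2 t h0 h1)).trans ?_
    rw [hb, mul_pow]
    have : (1 : ℝ) ≤ (2 * π) ^ 2 := one_le_pow₀ (by linarith [Real.two_le_pi])
    nlinarith [sq_nonneg ν]
  have hpde : ∀ t, 0 ≤ t → t ≤ T → ∀ x, timeDeriv F (t, x) + γ * iteratedDeriv 0 (v t) x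
      + iteratedDeriv 3 (v t) x + (iteratedDeriv 1 (ξ t) x * iteratedDeriv 0 (v t) x
      + iteratedDeriv 0 (ξ t) x * iteratedDeriv 1 (v t) x)
      + iteratedDeriv 0 (v t) x * iteratedDeriv 1 (v t) x + ε * iteratedDeriv 4 (v t) x
      = iteratedDeriv 0 (η t) x := by
    intro t h0 h1 x
    have hprod := (((hξj t h0 h1).hasDerivAt 0 x).mul ((hvj t h0 h1).hasDerivAt 0 x)).deriv
    have := heq t x h0 h1
    rw [(hasDerivAt_timeDeriv hs t x).deriv] at this
    simp only [iteratedDeriv_zero, iteratedDeriv_one, zero_add] at hprod ⊢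
    have e : (fun y => ξ t y * v t y) = ξ t * v t := rfl
    rw [e, hprod] at this
    exact this
  have h₀ := fun t h0 h1 => ((hvj t h0 h1).energy_le hγ (hξj t h0 h1) (hηj t h0 h1)
    (fun x hx => (hξb t h0 h1 x hx).1) (hpde t h0 h1)).trans
    (sub_le_sub_right (add_le_add_right (hη₀ t h0 h1) _) _)
  have hI := fun t h0 h1 => (hvj t h0 h1).modified_energy_le hγ hε ha0 (hξj t h0 h1) (hηj t h0 h1)
    (fun x hx => (hξb t h0 h1 x hx).1) (fun x hx => (hξb t h0 h1 x hx).2)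
    (hasDerivAt_spaceDeriv hWs t)
    (hW₁s.continuous.comp (by fun_prop : Continuous fun x => (t, x))) (hpde t h0 h1)
  have hnn : ∀ k t, 0 ≤ ∫ x in (0 : ℝ)..(2 * π), iteratedDeriv k (v t) x ^ 2 := fun k t =>
    intervalIntegral.integral_nonneg (by positivity) fun x _ => sq_nonneg _
  have hN₀R : ∀ t, 0 ≤ t → t ≤ T → ∫ x in (0 : ℝ)..(2 * π), iteratedDeriv 0 (v t) x ^ 2 ≤ R := by
    intro t h0 h1
    refine le_energyBound ha0 hb0 (hnn 0) dN₀ (fun s h0 h1 => (h₀ s h0 h1).trans ?_) ?_ h0 h1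
    · have := mul_nonneg (by positivity : 0 ≤ 2 * ε) (hnn 2 s)
      linarith
    · exact integral_sq_le_of_Hnorm_le (k := 0) (by simpa [Hnorm] using hμ₀)
  have key := bounds_of_energy_inequalities
    (Q := fun s => ∫ x in (0 : ℝ)..(2 * π), iteratedDeriv 0 (v s) x ^ 3) hγ hε ha0 hb0 hT hR0 dN₀ dI
    (intervalIntegral.continuous_parametric_intervalIntegral_of_continuous'
      (f := fun s x => iteratedDeriv 3 (v s) x ^ 2) (V3.fun_pow 2) 0 (2 * π))
    (hnn 0) (hnn 1) (hnn 2) (hnn 3) hN₀R h₀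
    (fun t h0 h1 => by linarith [hI t h0 h1, hη₀ t h0 h1, hη₁ t h0 h1])
    (fun t h0 h1 => (hvj t h0 h1).abs_integral_cube_le hR0 (hN₀R t h0 h1))
    (integral_sq_le_of_Hnorm_le hμ₁)
  simp only [Hnorm, L2norm_sq]
  exact key

/-- uniform-in-`ε` `H¹` a priori bound for the parabolic regularization. -/
theorem reg_H1_apriori (γ T μ ρ ν : ℝ)
    (hγ : 0 < γ) (hT : 0 < T) (hμ : 0 < μ) (hρ : 0 < ρ) (hν : 0 < ν) :
    ∃ C : ℝ, 1 ≤ C ∧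
      ∀ ε : ℝ, 0 < ε → ε ≤ 1 →
        ∀ ξ η v : ℝ → ℝ → ℝ,
          RegData T 3 ρ ξ → RegData T 1 ν η →
          IsRegSol γ ε T ξ η v → L2norm (v 0) + Hnorm 1 (v 0) ≤ μ →
          ∀ t : ℝ, 0 ≤ t → t ≤ T →
            Hnorm 1 (v t)
              + Real.sqrt ε * Real.sqrt (∫ s in (0:ℝ)..T, (Hnorm 3 (v s)) ^ 2) ≤ C := by
  have hM : 0 ≤ modifiedEnergyBound γ ((2 * π) ^ 2 * ρ) ((2 * π * ν) ^ 2) T μ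
      (energyBound ((2 * π) ^ 2 * ρ) ((2 * π * ν) ^ 2) T μ) := by
    unfold modifiedEnergyBound
    positivity
  set M := modifiedEnergyBound γ ((2 * π) ^ 2 * ρ) ((2 * π * ν) ^ 2) T μ
      (energyBound ((2 * π) ^ 2 * ρ) ((2 * π * ν) ^ 2) T μ)
  refine ⟨1 + √(3 / 2 * M) + √M, ?_, ?_⟩
  · linarith [Real.sqrt_nonneg (3 / 2 * M), Real.sqrt_nonneg M]
  intro ε hε _ ξ η v hξ hη hv hv₀ t h0 h1
  obtain ⟨hH, hD⟩ := hv.bounds (μ := μ) hγ.le hε.le hT.le hρ.le hξ hη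
    (by linarith [L2norm_nonneg (iteratedDeriv 1 (v 0)), show Hnorm 1 (v 0) = L2norm _ from rfl])
    (by linarith [L2norm_nonneg (v 0)])
  have h1 := Real.le_sqrt_of_sq_le (hH t h0 h1)
  have h2 := Real.sqrt_le_sqrt hD
  rw [Real.sqrt_mul hε.le] at h2
  linarith
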